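/- (Valiron's conjugation) Let Φ be an analytic self-map of ℍ with inf_{z∈ℍ} Im Φ(z)/Im z = A > 1. Then there exists a non-constant analytic map σ : ℍ → ℍ and a real number b such that σ ∘ Φ = Aσ + b on ℍ. Moreover, σ can be obtained as the locally uniform limit of the renormalized iterates τₙ ∘ Φⁿ, where τₙ(z) = (z − xₙ)/yₙ and xₙ + i yₙ = Φⁿ(z₀) for a fixed z₀ ∈ ℍ. -/

import Mathlib

open Complex Filter Real

open scoped ComplexConjugate Topology

/-- The quantity `4 cosh² (d / 2)`, where `d` is the hyperbolic distance in the upper half-plane. -/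
noncomputable def pickKernel (z w : ℂ) : ℝ := ‖z - conj w‖ ^ 2 / (z.im * w.im)

theorem pickKernel_nonneg {z w : ℂ} (hz : 0 < z.im) (hw : 0 < w.im) : 0 ≤ pickKernel z w := by
  unfold pickKernel; positivity

theorem norm_sub_conj_sq (z w : ℂ) : ‖z - conj w‖ ^ 2 = ‖z - w‖ ^ 2 + 4 * z.im * w.im := by
  simp only [Complex.sq_norm, Complex.normSq_apply, sub_re, sub_im, conj_re, conj_im]
  ring

theorem sub_conj_ne_zero {z w : ℂ} (hz : 0 < z.im) (hw : 0 < w.im) : z - conj w ≠ 0 := by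
  intro h
  have := congrArg Complex.im h
  simp at this
  linarith

theorem im_add_im_le_norm_sub_conj (z w : ℂ) : z.im + w.im ≤ ‖z - conj w‖ := by
  simpa using Complex.im_le_norm (z - conj w)

theorem norm_sub_le_norm_sub_conj {z w : ℂ} (hz : 0 ≤ z.im) (hw : 0 ≤ w.im) :
    ‖z - w‖ ≤ ‖z - conj w‖ := by
  refine (pow_le_pow_iff_left₀ (norm_nonneg _) (norm_nonneg _) two_ne_zero).1 ?_
  rw [norm_sub_conj_sq]
  nlinarith [mul_nonneg hz hw]

/-- The **Schwarz–Pick lemma** in the upper half-plane. -/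
theorem schwarzPick_upperHalfPlane {f : ℂ → ℂ} (hd : DifferentiableOn ℂ f {z : ℂ | 0 < z.im})
    (hm : Set.MapsTo f {z : ℂ | 0 < z.im} {z : ℂ | 0 < z.im}) {z w : ℂ}
    (hz : 0 < z.im) (hw : 0 < w.im) :
    ‖f z - f w‖ * ‖z - conj w‖ ≤ ‖z - w‖ * ‖f z - conj (f w)‖ := by
  have hfz : 0 < (f z).im := hm hz
  have hfw : 0 < (f w).im := hm hw
  let C : ℂ → ℂ := fun ζ ↦ (w - conj w * ζ) / (1 - ζ)
  have h1 : ∀ ζ ∈ Metric.ball (0 : ℂ) 1, 1 - ζ ≠ 0 := by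
    intro ζ hζ h
    have : ζ = 1 := (sub_eq_zero.1 h).symm
    simp [this] at hζ
  have hCm : Set.MapsTo C (Metric.ball 0 1) {z : ℂ | 0 < z.im} := by
    intro ζ hζ
    have hs : 0 < Complex.normSq (1 - ζ) := Complex.normSq_pos.2 (h1 ζ hζ)
    have hn : ‖ζ‖ ^ 2 < 1 := by
      have : ‖ζ‖ < 1 := by simpa using hζ
      nlinarith [norm_nonneg ζ]
    rw [Complex.sq_norm, Complex.normSq_apply] at hn
    have : (C ζ).im = w.im * (1 - (ζ.re * ζ.re + ζ.im * ζ.im)) / Complex.normSq (1 - ζ) := by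
      simp only [C, Complex.div_im]
      field_simp
      simp
      ring
    change 0 < (C ζ).im
    rw [this]
    exact div_pos (mul_pos hw (by linarith)) hs
  have hCd : DifferentiableOn ℂ C (Metric.ball 0 1) := by
    intro ζ hζ
    have := h1 ζ hζ
    exact DifferentiableAt.differentiableWithinAt (by fun_prop (disch := assumption))
  let F : ℂ → ℂ := fun ζ ↦ (f (C ζ) - f w) / (f (C ζ) - conj (f w))
  have hFd : DifferentiableOn ℂ F (Metric.ball 0 1) := by
    have h := hd.comp hCd hCm
    exact (h.sub_const _).div (h.sub_const _) fun ζ hζ ↦ sub_conj_ne_zero (hm (hCm hζ)) hfw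
  have hFm : Set.MapsTo F (Metric.ball 0 1) (Metric.closedBall 0 1) := by
    intro ζ hζ
    have h := hm (hCm hζ)
    have h' := norm_pos_iff.2 (sub_conj_ne_zero h hfw)
    simp only [F, mem_closedBall_zero_iff, norm_div]
    rw [div_le_one h']
    exact norm_sub_le_norm_sub_conj (le_of_lt h) hfw.le
  have hF0 : F 0 = 0 := by simp [F, C]
  have hzw := sub_conj_ne_zero hz hw
  set ζ : ℂ := (z - w) / (z - conj w) with hζ
  have hζ1 : ‖ζ‖ < 1 := by
    rw [hζ, norm_div, div_lt_one (norm_pos_iff.2 hzw)]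
    refine lt_of_pow_lt_pow_left₀ 2 (norm_nonneg _) ?_
    rw [norm_sub_conj_sq]
    nlinarith [mul_pos hz hw]
  have hCζ : C ζ = z := by
    have h2 : 1 - ζ ≠ 0 := h1 ζ (by simpa using hζ1)
    simp only [C]
    rw [div_eq_iff h2, hζ]
    field_simp
    ring
  have key := Complex.norm_le_norm_of_mapsTo_ball hFd hFm hF0 hζ1
  simp only [F, hCζ] at key
  rw [hζ, norm_div, norm_div, div_le_div_iff₀ (norm_pos_iff.2 (sub_conj_ne_zero hfz hfw))
    (norm_pos_iff.2 hzw)] at key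
  exact key

theorem norm_sub_conj_sq_mul_le {f : ℂ → ℂ} (hd : DifferentiableOn ℂ f {z : ℂ | 0 < z.im})
    (hm : Set.MapsTo f {z : ℂ | 0 < z.im} {z : ℂ | 0 ≤ z.im}) {z w : ℂ}
    (hz : 0 < z.im) (hw : 0 < w.im) :
    ‖f z - conj (f w)‖ ^ 2 ≤ pickKernel z w * ((f z).im * (f w).im) := by
  have hε : ∀ ε : ℝ, 0 < ε → ‖(f z + ε * I) - conj (f w + ε * I)‖ ^ 2 ≤
      pickKernel z w * ((f z + ε * I).im * (f w + ε * I).im) := by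
    intro ε hε
    have hm' : Set.MapsTo (fun z ↦ f z + ε * I) {z : ℂ | 0 < z.im} {z : ℂ | 0 < z.im} := by
      intro u hu
      have := hm hu
      simp at this ⊢
      linarith
    have h := schwarzPick_upperHalfPlane (hd.add_const (ε * I)) hm' hz hw
    have h2 := pow_le_pow_left₀ (by positivity) h 2
    have e1 := norm_sub_conj_sq z w
    have e2 := norm_sub_conj_sq (f z + ε * I) (f w + ε * I)
    rw [mul_pow, mul_pow] at h2
    have hp := mul_pos hz hw
    rw [pickKernel, div_mul_eq_mul_div, le_div_iff₀ hp]
    nlinarith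
  have hc : ∀ u : ℂ, Tendsto (fun ε : ℝ ↦ u + ε * I) (𝓝[>] 0) (𝓝 u) := by
    intro u
    have : Continuous fun ε : ℝ ↦ u + ε * I := by fun_prop
    simpa using (this.tendsto 0).mono_left nhdsWithin_le_nhds
  have hcim : ∀ u : ℂ, Tendsto (fun ε : ℝ ↦ (u + ε * I).im) (𝓝[>] 0) (𝓝 u.im) := fun u ↦
    (Complex.continuous_im.tendsto u).comp (hc u)
  refine le_of_tendsto_of_tendsto
    (((hc (f z)).sub ((Complex.continuous_conj.tendsto _).comp (hc (f w)))).norm.pow 2)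
    (((hcim (f z)).mul (hcim (f w))).const_mul (pickKernel z w)) ?_
  filter_upwards [self_mem_nhdsWithin] with ε h using hε ε h

/-- **Harnack inequality** for holomorphic maps into the closed upper half-plane. -/
theorem norm_sub_conj_le {f : ℂ → ℂ} (hd : DifferentiableOn ℂ f {z : ℂ | 0 < z.im})
    (hm : Set.MapsTo f {z : ℂ | 0 < z.im} {z : ℂ | 0 ≤ z.im}) {z w : ℂ}
    (hz : 0 < z.im) (hw : 0 < w.im) :
    ‖f z - conj (f w)‖ ≤ pickKernel z w * (f w).im := by
  have h := norm_sub_conj_sq_mul_le hd hm hz hw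
  have hfz : 0 ≤ (f z).im := hm hz
  have hfw : 0 ≤ (f w).im := hm hw
  have hK := pickKernel_nonneg hz hw
  rcases (norm_nonneg (f z - conj (f w))).eq_or_lt with h0 | h0
  · rw [← h0]; positivity
  · have h1 := im_add_im_le_norm_sub_conj (f z) (f w)
    refine le_of_mul_le_mul_right ?_ h0
    calc ‖f z - conj (f w)‖ * ‖f z - conj (f w)‖ ≤ pickKernel z w * ((f z).im * (f w).im) := by
          rw [← sq]; exact h
      _ ≤ pickKernel z w * (‖f z - conj (f w)‖ * (f w).im) := by gcongr; linarith
      _ = _ := by ring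

theorem norm_sub_le_pickKernel_mul {f : ℂ → ℂ} (hd : DifferentiableOn ℂ f {z : ℂ | 0 < z.im})
    (hm : Set.MapsTo f {z : ℂ | 0 < z.im} {z : ℂ | 0 ≤ z.im}) {z w : ℂ}
    (hz : 0 < z.im) (hw : 0 < w.im) : ‖f z - f w‖ ≤ pickKernel z w * (f w).im :=
  (norm_sub_le_norm_sub_conj (hm hz) (hm hw)).trans (norm_sub_conj_le hd hm hz hw)

theorem im_le_pickKernel_mul {f : ℂ → ℂ} (hd : DifferentiableOn ℂ f {z : ℂ | 0 < z.im})
    (hm : Set.MapsTo f {z : ℂ | 0 < z.im} {z : ℂ | 0 ≤ z.im}) {z w : ℂ}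
    (hz : 0 < z.im) (hw : 0 < w.im) : (f z).im ≤ pickKernel z w * (f w).im := by
  have h1 := im_add_im_le_norm_sub_conj (f z) (f w)
  have h2 : 0 ≤ (f w).im := hm hw
  linarith [norm_sub_conj_le hd hm hz hw]

/-- Holomorphic self-maps of the upper half-plane decrease the hyperbolic distance. -/
theorem pickKernel_map_le {f : ℂ → ℂ} (hd : DifferentiableOn ℂ f {z : ℂ | 0 < z.im})
    (hm : Set.MapsTo f {z : ℂ | 0 < z.im} {z : ℂ | 0 < z.im}) {z w : ℂ}
    (hz : 0 < z.im) (hw : 0 < w.im) : pickKernel (f z) (f w) ≤ pickKernel z w := by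
  have hfz : 0 < (f z).im := hm hz
  have hfw : 0 < (f w).im := hm hw
  rw [pickKernel, div_le_iff₀ (mul_pos hfz hfw)]
  exact norm_sub_conj_sq_mul_le hd (hm.mono_right fun u (hu : 0 < u.im) ↦ hu.le) hz hw

/-- A holomorphic self-map of the upper half-plane fixing `I` and almost fixing a second point
is close to the identity. -/
theorem norm_map_sub_le_of_fixed {G : ℂ → ℂ} (hd : DifferentiableOn ℂ G {z : ℂ | 0 < z.im})
    (hm : Set.MapsTo G {z : ℂ | 0 < z.im} {z : ℂ | 0 < z.im}) (hI : G I = I) {z w : ℂ}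
    (hz : 0 < z.im) (hw : 0 < w.im) (hwI : w ≠ I) :
    ‖G z - z‖ ≤ ‖G z + I‖ * ‖z + I‖ * (pickKernel z w + 1) *
      (‖G w - w‖ / (‖G w + I‖ * ‖w - I‖)) := by
  have hne : ∀ u : ℂ, 0 < u.im → u + I ≠ 0 := by
    intro u hu h
    have := congrArg Complex.im h
    simp at this
    linarith
  let B : ℂ → ℂ := fun z ↦ (G z - I) / (G z + I)
  have hBd : DifferentiableOn ℂ B {z : ℂ | 0 < z.im} :=
    (hd.sub_const _).div (hd.add_const _) fun u hu ↦ hne _ (hm hu)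
  have hopen : IsOpen {z : ℂ | 0 < z.im} := isOpen_lt continuous_const Complex.continuous_im
  have hImem : {z : ℂ | 0 < z.im} ∈ 𝓝 I := hopen.mem_nhds (by simp)
  let H : ℂ → ℂ := fun z ↦ dslope B I z * (z + I)
  have hHd : DifferentiableOn ℂ H {z : ℂ | 0 < z.im} :=
    ((Complex.differentiableOn_dslope hImem).2 hBd).mul (by fun_prop)
  have hBI : B I = 0 := by simp [B, hI]
  have hHne : ∀ u, u ≠ I → H u = (G u - I) / (G u + I) / (u - I) * (u + I) := by
    intro u hu
    simp [H, dslope_of_ne _ hu, slope_def_field, hBI, B]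
  have hH1 : ∀ u : ℂ, 0 < u.im → u ≠ I → ‖H u‖ ≤ 1 := by
    intro u hu hne'
    have h := schwarzPick_upperHalfPlane hd hm hu (w := I) (by simp)
    rw [hI, conj_I, sub_neg_eq_add, sub_neg_eq_add] at h
    have p1 := norm_pos_iff.2 (hne _ (hm hu))
    have p2 := norm_pos_iff.2 (sub_ne_zero.2 hne')
    rw [hHne u hne', norm_mul, norm_div, norm_div, div_div, div_mul_eq_mul_div,
      div_le_one (by positivity)]
    linarith
  have hHI : ‖H I‖ ≤ 1 := by
    have hc : Tendsto (fun u ↦ ‖H u‖) (𝓝[≠] I) (𝓝 ‖H I‖) :=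
      ((hHd.differentiableAt hImem).continuousAt.norm.tendsto).mono_left nhdsWithin_le_nhds
    refine le_of_tendsto hc ?_
    filter_upwards [self_mem_nhdsWithin, mem_nhdsWithin_of_mem_nhds hImem] with u h1 h2
      using hH1 u h2 h1
  have hfd : DifferentiableOn ℂ (fun u ↦ I * (1 - H u)) {z : ℂ | 0 < z.im} :=
    (hHd.const_sub 1).const_mul I
  have hfm : Set.MapsTo (fun u ↦ I * (1 - H u)) {z : ℂ | 0 < z.im} {z : ℂ | 0 ≤ z.im} := by
    intro u hu
    have : ‖H u‖ ≤ 1 := by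
      rcases eq_or_ne u I with rfl | h
      · exact hHI
      · exact hH1 u hu h
    have := (Complex.re_le_norm (H u)).trans this
    simpa using this
  have h1 := norm_sub_le_pickKernel_mul hfd hfm hz hw
  have hK := pickKernel_nonneg hz hw
  have h2 : ‖1 - H z‖ ≤ (pickKernel z w + 1) * ‖1 - H w‖ := by
    have h3 : (I * (1 - H w)).im ≤ ‖1 - H w‖ := by
      simpa using Complex.im_le_norm (I * (1 - H w))
    have h4 : ‖I * (1 - H z) - I * (1 - H w)‖ = ‖(1 - H z) - (1 - H w)‖ := by
      rw [← mul_sub, norm_mul, norm_I, one_mul]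
    have h5 := norm_sub_norm_le (1 - H z) (1 - H w)
    have h6 := mul_le_mul_of_nonneg_left h3 hK
    linarith
  have hform : ∀ u : ℂ, 0 < u.im → u ≠ I →
      ‖1 - H u‖ = 2 * (‖G u - u‖ / (‖G u + I‖ * ‖u - I‖)) := by
    intro u hu hneu
    have a1 := hne _ (hm hu)
    have a2 := sub_ne_zero.2 hneu
    have : 1 - H u = -(2 * I) * ((G u - u) / ((G u + I) * (u - I))) := by
      rw [hHne u hneu]
      field_simp
      ring
    rw [this]
    simp
  rcases eq_or_ne z I with rfl | hzI
  · simp only [hI, sub_self, norm_zero]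
    positivity
  rw [hform z hz hzI, hform w hw hwI] at h2
  have b1 := norm_pos_iff.2 (hne _ (hm hz))
  have b2 := norm_pos_iff.2 (sub_ne_zero.2 hzI)
  have b3 : ‖z - I‖ ≤ ‖z + I‖ := by
    simpa using norm_sub_le_norm_sub_conj (w := I) hz.le (by simp)
  have h7 : ‖G z - z‖ / (‖G z + I‖ * ‖z - I‖) ≤
      (pickKernel z w + 1) * (‖G w - w‖ / (‖G w + I‖ * ‖w - I‖)) := by linarith
  rw [div_le_iff₀ (by positivity)] at h7
  refine h7.trans ?_
  calc _ ≤ (pickKernel z w + 1) * (‖G w - w‖ / (‖G w + I‖ * ‖w - I‖)) * (‖G z + I‖ * ‖z + I‖) := by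
        gcongr
    _ = _ := by ring

/-- A real sequence with vanishing increments converges as soon as its absolute value does. -/
theorem exists_tendsto_of_tendsto_abs {u : ℕ → ℝ} {s : ℝ}
    (habs : Tendsto (fun n ↦ |u n|) atTop (𝓝 s))
    (hdiff : Tendsto (fun n ↦ u (n + 1) - u n) atTop (𝓝 0)) :
    ∃ b, Tendsto u atTop (𝓝 b) := by
  have hs : 0 ≤ s := ge_of_tendsto' habs fun n ↦ abs_nonneg _
  rcases hs.eq_or_lt with rfl | hs
  · exact ⟨0, (tendsto_zero_iff_abs_tendsto_zero u).2 habs⟩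
  have h1 : ∀ᶠ n in atTop, s / 2 < |u n| := habs.eventually (lt_mem_nhds (by linarith))
  have h2 : ∀ᶠ n in atTop, |u (n + 1) - u n| < s := by
    have := (tendsto_zero_iff_abs_tendsto_zero _).1 hdiff
    exact this.eventually (gt_mem_nhds hs)
  obtain ⟨N, hN⟩ := eventually_atTop.1 (h1.and h2)
  rcases le_total 0 (u N) with hpos | hneg
  · have hall : ∀ n ≥ N, 0 ≤ u n := by
      intro n hn
      induction n, hn using Nat.le_induction with
      | base => exact hpos
      | succ n hn ih =>
        by_contra! hlt
        have a1 := (hN n hn).1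
        have a2 := (hN n hn).2
        have a3 := (hN (n + 1) (by omega)).1
        rw [abs_of_nonneg ih] at a1
        rw [abs_of_neg hlt] at a3
        rw [abs_lt] at a2
        linarith
    refine ⟨s, habs.congr' ?_⟩
    filter_upwards [eventually_ge_atTop N] with n hn using abs_of_nonneg (hall n hn)
  · have hall : ∀ n ≥ N, u n ≤ 0 := by
      intro n hn
      induction n, hn using Nat.le_induction with
      | base => exact hneg
      | succ n hn ih =>
        by_contra! hlt
        have a1 := (hN n hn).1
        have a2 := (hN n hn).2
        have a3 := (hN (n + 1) (by omega)).1
        rw [abs_of_nonpos ih] at a1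
        rw [abs_of_pos hlt] at a3
        rw [abs_lt] at a2
        linarith
    refine ⟨-s, habs.neg.congr' ?_⟩
    filter_upwards [eventually_ge_atTop N] with n hn
    rw [abs_of_nonpos (hall n hn), neg_neg]

theorem orbit_im_pos {Φ : ℂ → ℂ} (hm : Set.MapsTo Φ {z : ℂ | 0 < z.im} {z : ℂ | 0 < z.im})
    {z : ℂ} (hz : 0 < z.im) (n : ℕ) : 0 < (Φ^[n] z).im :=
  hm.iterate n hz

theorem differentiableOn_iterate {Φ : ℂ → ℂ} {s : Set ℂ} (hd : DifferentiableOn ℂ Φ s)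
    (hm : Set.MapsTo Φ s s) (n : ℕ) : DifferentiableOn ℂ Φ^[n] s := by
  induction n with
  | zero => exact differentiableOn_id
  | succ n ih => exact ih.comp hd hm

theorem mul_im_le_of_isGLB {Φ : ℂ → ℂ} {A : ℝ}
    (hA : IsGLB {r : ℝ | ∃ z : ℂ, 0 < z.im ∧ r = (Φ z).im / z.im} A) {z : ℂ} (hz : 0 < z.im) :
    A * z.im ≤ (Φ z).im :=
  (le_div_iff₀ hz).1 (hA.1 ⟨z, hz, rfl⟩)

section Orbit

variable {Φ : ℂ → ℂ} (hd : DifferentiableOn ℂ Φ {z : ℂ | 0 < z.im})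
  (hm : Set.MapsTo Φ {z : ℂ | 0 < z.im} {z : ℂ | 0 < z.im}) {z₀ : ℂ} (hz₀ : 0 < z₀.im)
include hd hm hz₀

theorem antitone_pickKernel_orbit :
    Antitone fun n ↦ pickKernel (Φ^[n + 1] z₀) (Φ^[n] z₀) := by
  refine antitone_nat_of_succ_le fun n ↦ ?_
  simpa only [Function.iterate_succ_apply'] using pickKernel_map_le hd hm
    (orbit_im_pos hm hz₀ (n + 1)) (orbit_im_pos hm hz₀ n)

theorem pickKernel_orbit_le (n : ℕ) :
    pickKernel (Φ^[n + 1] z₀) (Φ^[n] z₀) ≤ pickKernel (Φ z₀) z₀ :=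
  antitone_pickKernel_orbit hd hm hz₀ (Nat.zero_le n)

theorem norm_orbit_succ_sub_le (n : ℕ) :
    ‖Φ^[n + 1] z₀ - Φ^[n] z₀‖ ≤ pickKernel (Φ z₀) z₀ * (Φ^[n] z₀).im := by
  have hn := orbit_im_pos hm hz₀ n
  refine (norm_sub_le_pickKernel_mul (f := fun z ↦ z) differentiableOn_id
    (fun u (hu : 0 < u.im) ↦ hu.le) (orbit_im_pos hm hz₀ (n + 1)) hn).trans ?_
  exact mul_le_mul_of_nonneg_right (pickKernel_orbit_le hd hm hz₀ n) hn.le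

variable {A : ℝ} (hA1 : 1 < A)
  (hA : IsGLB {r : ℝ | ∃ z : ℂ, 0 < z.im ∧ r = (Φ z).im / z.im} A)
include hA1 hA

omit hd in
theorem tendsto_orbit_im_atTop : Tendsto (fun n ↦ (Φ^[n] z₀).im) atTop atTop := by
  have hge : ∀ n : ℕ, A ^ n * z₀.im ≤ (Φ^[n] z₀).im := by
    intro n
    induction n with
    | zero => simp
    | succ n ih =>
      rw [Function.iterate_succ_apply', pow_succ']
      have := mul_im_le_of_isGLB hA (orbit_im_pos hm hz₀ n)
      have := mul_le_mul_of_nonneg_left ih (by linarith : 0 ≤ A)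
      linarith
  exact tendsto_atTop_mono hge ((tendsto_pow_atTop_atTop_of_one_lt hA1).atTop_mul_const hz₀)

/-- Orbits approach infinity non-tangentially. -/
theorem norm_orbit_sub_le (n : ℕ) :
    ‖Φ^[n] z₀ - z₀‖ ≤ pickKernel (Φ z₀) z₀ / (A - 1) * (Φ^[n] z₀).im := by
  have hA' : 0 < A - 1 := by linarith
  have hK := pickKernel_nonneg (hm hz₀ : 0 < (Φ z₀).im) hz₀
  induction n with
  | zero => simpa using by positivity
  | succ n ih =>
    have h1 := norm_orbit_succ_sub_le hd hm hz₀ n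
    have h2 := mul_im_le_of_isGLB hA (orbit_im_pos hm hz₀ n)
    rw [← Function.iterate_succ_apply' Φ n z₀] at h2
    have h3 := norm_sub_le_norm_sub_add_norm_sub (Φ^[n + 1] z₀) (Φ^[n] z₀) z₀
    have h4 := mul_le_mul_of_nonneg_left h2 (div_nonneg hK hA'.le)
    have h5 : pickKernel (Φ z₀) z₀ / (A - 1) * (A * (Φ^[n] z₀).im) =
        pickKernel (Φ z₀) z₀ * (Φ^[n] z₀).im +
          pickKernel (Φ z₀) z₀ / (A - 1) * (Φ^[n] z₀).im := by
      field_simp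
      ring
    linarith

theorem tendsto_orbit_im_ratio :
    Tendsto (fun n ↦ (Φ^[n + 1] z₀).im / (Φ^[n] z₀).im) atTop (𝓝 A) := by
  set K₀ := pickKernel (Φ z₀) z₀ with hK₀
  have hK : 0 ≤ K₀ := pickKernel_nonneg (hm hz₀ : 0 < (Φ z₀).im) hz₀
  set C := K₀ / (A - 1) with hC
  have hC0 : 0 ≤ C := div_nonneg hK (by linarith)
  have hqd : DifferentiableOn ℂ (fun z ↦ Φ z - A * z) {z : ℂ | 0 < z.im} :=
    hd.sub (by fun_prop)
  have hqm : Set.MapsTo (fun z ↦ Φ z - A * z) {z : ℂ | 0 < z.im} {z : ℂ | 0 ≤ z.im} := by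
    intro u hu
    have := mul_im_le_of_isGLB hA hu
    simpa using this
  have hge : ∀ n, A ≤ (Φ^[n + 1] z₀).im / (Φ^[n] z₀).im := by
    intro n
    rw [le_div_iff₀ (orbit_im_pos hm hz₀ n), Function.iterate_succ_apply']
    exact mul_im_le_of_isGLB hA (orbit_im_pos hm hz₀ n)
  refine tendsto_order.2 ⟨fun a ha ↦ Eventually.of_forall fun n ↦ ha.trans_le (hge n),
    fun a ha ↦ ?_⟩
  set δ := (a - A) / (C + 1) ^ 2 with hδ
  have hδ0 : 0 < δ := div_pos (by linarith) (by positivity)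
  obtain ⟨_, ⟨p, hp, rfl⟩, -, hpA⟩ := hA.exists_between (b := A + δ) (by linarith)
  rw [div_lt_iff₀ hp] at hpA
  filter_upwards [(tendsto_orbit_im_atTop hm hz₀ hA1 hA).eventually_ge_atTop ‖z₀ - conj p‖]
    with n hn
  have hy := orbit_im_pos hm hz₀ n
  have h1 : ‖Φ^[n] z₀ - conj p‖ ≤ (C + 1) * (Φ^[n] z₀).im := by
    have := norm_sub_le_norm_sub_add_norm_sub (Φ^[n] z₀) z₀ (conj p)
    have := norm_orbit_sub_le hd hm hz₀ hA1 hA n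
    linarith
  have h2 := im_le_pickKernel_mul hqd hqm hy hp
  simp only [sub_im, im_ofReal_mul] at h2
  have hpos : 0 < pickKernel (Φ^[n] z₀) p := by
    have := norm_pos_iff.2 (sub_conj_ne_zero hy hp)
    unfold pickKernel
    positivity
  have h3 : pickKernel (Φ^[n] z₀) p * ((Φ p).im - A * p.im) <
      pickKernel (Φ^[n] z₀) p * (δ * p.im) := by
    gcongr
    linarith
  have h4 : pickKernel (Φ^[n] z₀) p * (δ * p.im) ≤ (a - A) * (Φ^[n] z₀).im := by
    have h5 := pow_le_pow_left₀ (norm_nonneg _) h1 2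
    calc pickKernel (Φ^[n] z₀) p * (δ * p.im)
        = ‖Φ^[n] z₀ - conj p‖ ^ 2 * δ / (Φ^[n] z₀).im := by
          rw [pickKernel]; field_simp
      _ ≤ ((C + 1) * (Φ^[n] z₀).im) ^ 2 * δ / (Φ^[n] z₀).im := by gcongr
      _ = (a - A) * (Φ^[n] z₀).im := by
          rw [hδ]; field_simp
  rw [div_lt_iff₀ hy, Function.iterate_succ_apply']
  linarith

theorem exists_tendsto_orbit_re_diff :
    ∃ b : ℝ, Tendsto (fun n ↦ ((Φ^[n + 1] z₀).re - (Φ^[n] z₀).re) / (Φ^[n] z₀).im)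
      atTop (𝓝 b) := by
  set K₀ := pickKernel (Φ z₀) z₀ with hK₀
  have hK : 0 ≤ K₀ := pickKernel_nonneg (hm hz₀ : 0 < (Φ z₀).im) hz₀
  set a : ℕ → ℝ := fun n ↦ (Φ^[n + 1] z₀).im / (Φ^[n] z₀).im with ha
  set u : ℕ → ℝ := fun n ↦ ((Φ^[n + 1] z₀).re - (Φ^[n] z₀).re) / (Φ^[n] z₀).im with hu
  have hlim : Tendsto a atTop (𝓝 A) := tendsto_orbit_im_ratio hd hm hz₀ hA1 hA
  have hy : ∀ n, 0 < (Φ^[n] z₀).im := orbit_im_pos hm hz₀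
  have hapos : ∀ n, 0 < a n := fun n ↦ div_pos (hy _) (hy _)
  have hqd : DifferentiableOn ℂ (fun z ↦ Φ z - A * z) {z : ℂ | 0 < z.im} :=
    hd.sub (by fun_prop)
  have hqm : Set.MapsTo (fun z ↦ Φ z - A * z) {z : ℂ | 0 < z.im} {z : ℂ | 0 ≤ z.im} := by
    intro u hu
    have := mul_im_le_of_isGLB hA hu
    simpa using this
  have hub : ∀ n, |u n| ≤ K₀ := by
    intro n
    rw [hu, abs_div, abs_of_pos (hy n), div_le_iff₀ (hy n), ← sub_re]
    exact (Complex.abs_re_le_norm _).trans (norm_orbit_succ_sub_le hd hm hz₀ n)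
  have hincr : ∀ n, |u (n + 1) * a n - A * u n| ≤ K₀ * (a n - A) := by
    intro n
    have h1 := norm_sub_le_pickKernel_mul hqd hqm (hy (n + 1)) (hy n)
    have hq0 : 0 ≤ (Φ (Φ^[n] z₀) - A * Φ^[n] z₀).im := hqm (hy n)
    have h2 := (Complex.abs_re_le_norm _).trans (h1.trans
      (mul_le_mul_of_nonneg_right (pickKernel_orbit_le hd hm hz₀ n) hq0))
    simp only [← Function.iterate_succ_apply' Φ, sub_re, sub_im, re_ofReal_mul,
      im_ofReal_mul] at h2
    have e1 : u (n + 1) * a n - A * u n = ((Φ^[n + 1 + 1] z₀).re - A * (Φ^[n + 1] z₀).re -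
        ((Φ^[n + 1] z₀).re - A * (Φ^[n] z₀).re)) / (Φ^[n] z₀).im := by
      have := (hy n).ne'
      have := (hy (n + 1)).ne'
      simp only [hu, ha]
      field_simp
      ring
    have e2 : K₀ * (a n - A) =
        K₀ * ((Φ^[n + 1] z₀).im - A * (Φ^[n] z₀).im) / (Φ^[n] z₀).im := by
      have := (hy n).ne'
      simp only [ha]
      field_simp
    rw [e1, e2, abs_div, abs_of_pos (hy n)]
    exact div_le_div_of_nonneg_right h2 (hy n).le
  have hdiff : Tendsto (fun n ↦ u (n + 1) - u n) atTop (𝓝 0) := by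
    have hz : Tendsto (fun n ↦ 2 * K₀ / A * |a n - A|) atTop (𝓝 0) := by
      simpa using ((hlim.sub_const A).abs).const_mul (2 * K₀ / A)
    refine squeeze_zero_norm (fun n ↦ ?_) hz
    have h1 : A * (u (n + 1) - u n) = (u (n + 1) * a n - A * u n) - u (n + 1) * (a n - A) := by
      ring
    have h2 := abs_sub (u (n + 1) * a n - A * u n) (u (n + 1) * (a n - A))
    rw [← h1, abs_mul, abs_mul, abs_of_pos (by linarith : 0 < A)] at h2
    have h3 := mul_le_mul_of_nonneg_right (hub (n + 1)) (abs_nonneg (a n - A))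
    have h4 := mul_le_mul_of_nonneg_left (le_abs_self (a n - A)) hK
    have h5 := hincr n
    rw [Real.norm_eq_abs, div_mul_eq_mul_div, le_div_iff₀ (by linarith)]
    linarith
  have hκ : ∃ κ, Tendsto (fun n ↦ pickKernel (Φ^[n + 1] z₀) (Φ^[n] z₀)) atTop (𝓝 κ) :=
    ⟨_, tendsto_atTop_ciInf (antitone_pickKernel_orbit hd hm hz₀)
      ⟨0, by rintro _ ⟨n, rfl⟩; exact pickKernel_nonneg (hy _) (hy _)⟩⟩
  obtain ⟨κ, hκ⟩ := hκ
  have habs : ∀ n, |u n| =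
      √(pickKernel (Φ^[n + 1] z₀) (Φ^[n] z₀) * a n - (a n + 1) ^ 2) := by
    intro n
    rw [← Real.sqrt_sq_eq_abs]
    congr 1
    have := (hy n).ne'
    have := (hy (n + 1)).ne'
    simp only [hu, ha, pickKernel, Complex.sq_norm, Complex.normSq_apply, sub_re, sub_im,
      conj_re, conj_im]
    field_simp
    ring
  refine exists_tendsto_of_tendsto_abs (s := √(κ * A - (A + 1) ^ 2)) ?_ hdiff
  simp only [habs]
  exact ((hκ.mul hlim).sub ((hlim.add_const 1).pow 2)).sqrt

end Orbit

/-- The iterate `Φⁿ` followed by the affine map sending `Φⁿ z₀` to `I`. -/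
noncomputable def renormIterate (Φ : ℂ → ℂ) (z₀ : ℂ) (n : ℕ) (z : ℂ) : ℂ :=
  (Φ^[n] z - ((Φ^[n] z₀).re : ℂ)) / ((Φ^[n] z₀).im : ℂ)

theorem renormIterate_im (Φ : ℂ → ℂ) (z₀ : ℂ) (n : ℕ) (z : ℂ) :
    (renormIterate Φ z₀ n z).im = (Φ^[n] z).im / (Φ^[n] z₀).im := by
  simp [renormIterate, Complex.div_ofReal_im]

section Renormalization

variable {Φ : ℂ → ℂ} (hd : DifferentiableOn ℂ Φ {z : ℂ | 0 < z.im})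
  (hm : Set.MapsTo Φ {z : ℂ | 0 < z.im} {z : ℂ | 0 < z.im}) {z₀ : ℂ} (hz₀ : 0 < z₀.im)
include hm hz₀

theorem renormIterate_im_pos {z : ℂ} (hz : 0 < z.im) (n : ℕ) :
    0 < (renormIterate Φ z₀ n z).im := by
  rw [renormIterate_im]
  exact div_pos (orbit_im_pos hm hz n) (orbit_im_pos hm hz₀ n)

theorem renormIterate_self (n : ℕ) : renormIterate Φ z₀ n z₀ = I := by
  have : ((Φ^[n] z₀).im : ℂ) ≠ 0 := ofReal_ne_zero.2 (orbit_im_pos hm hz₀ n).ne'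
  rw [renormIterate, div_eq_iff this, sub_eq_iff_eq_add]
  conv_lhs => rw [← re_add_im (Φ^[n] z₀)]
  ring

theorem renormIterate_map (n : ℕ) (z : ℂ) :
    renormIterate Φ z₀ n (Φ z) =
      ((Φ^[n + 1] z₀).im / (Φ^[n] z₀).im : ℝ) * renormIterate Φ z₀ (n + 1) z +
        (((Φ^[n + 1] z₀).re - (Φ^[n] z₀).re) / (Φ^[n] z₀).im : ℝ) := by
  have h1 : ((Φ^[n] z₀).im : ℂ) ≠ 0 := ofReal_ne_zero.2 (orbit_im_pos hm hz₀ n).ne'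
  have h2 : ((Φ^[n + 1] z₀).im : ℂ) ≠ 0 := ofReal_ne_zero.2 (orbit_im_pos hm hz₀ (n + 1)).ne'
  simp only [renormIterate, ← Function.iterate_succ_apply Φ]
  push_cast
  field_simp
  ring

include hd

omit hz₀ in
theorem differentiableOn_renormIterate (n : ℕ) :
    DifferentiableOn ℂ (renormIterate Φ z₀ n) {z : ℂ | 0 < z.im} :=
  ((differentiableOn_iterate hd hm n).sub_const _).div_const _

theorem pickKernel_renormIterate_le {z w : ℂ} (hz : 0 < z.im) (hw : 0 < w.im) (n : ℕ) :
    pickKernel (renormIterate Φ z₀ n z) (renormIterate Φ z₀ n w) ≤ pickKernel z w :=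
  pickKernel_map_le (differentiableOn_renormIterate hd hm n)
    (fun _ hu ↦ renormIterate_im_pos hm hz₀ hu n) hz hw

theorem norm_renormIterate_add_I_le {z : ℂ} (hz : 0 < z.im) (n : ℕ) :
    ‖renormIterate Φ z₀ n z + I‖ ≤ pickKernel z z₀ := by
  simpa [renormIterate_self hm hz₀] using
    norm_sub_conj_le (differentiableOn_renormIterate hd hm n)
      (fun _ hu ↦ (renormIterate_im_pos hm hz₀ hu n).le) hz hz₀

theorem one_le_pickKernel_mul_renormIterate_im {z : ℂ} (hz : 0 < z.im) (n : ℕ) :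
    1 ≤ pickKernel z₀ z * (renormIterate Φ z₀ n z).im := by
  simpa [renormIterate_self hm hz₀] using
    im_le_pickKernel_mul (differentiableOn_renormIterate hd hm n)
      (fun _ hu ↦ (renormIterate_im_pos hm hz₀ hu n).le) hz₀ hz

/-- The renormalized iterates form a Cauchy sequence as soon as their values at a point `w` do,
provided these values stay away from the base point `I`. -/
theorem norm_renormIterate_sub_le {c : ℝ} (hc : 0 < c) {z w : ℂ} (hz : 0 < z.im)
    (hw : 0 < w.im) {n m : ℕ} (hnm : n ≤ m) (hwc : 1 + c ≤ (renormIterate Φ z₀ n w).im) :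
    ‖renormIterate Φ z₀ m z - renormIterate Φ z₀ n z‖ ≤
      pickKernel z z₀ ^ 2 * (pickKernel z w + 1) / c *
        ‖renormIterate Φ z₀ m w - renormIterate Φ z₀ n w‖ := by
  obtain ⟨k, rfl⟩ := Nat.exists_eq_add_of_le' hnm
  set g := renormIterate Φ z₀
  have hy := orbit_im_pos hm hz₀ n
  have hy0 : ((Φ^[n] z₀).im : ℂ) ≠ 0 := ofReal_ne_zero.2 hy.ne'
  let L : ℂ → ℂ := fun ζ ↦ (Φ^[n] z₀).im * ζ + (Φ^[n] z₀).re
  let G : ℂ → ℂ := fun ζ ↦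
    (Φ^[k] (L ζ) - ((Φ^[k + n] z₀).re : ℂ)) / ((Φ^[k + n] z₀).im : ℂ)
  have hLm : Set.MapsTo L {z : ℂ | 0 < z.im} {z : ℂ | 0 < z.im} := by
    intro ζ hζ
    have : 0 < (Φ^[n] z₀).im * ζ.im := mul_pos hy hζ
    simpa [L] using this
  have hGd : DifferentiableOn ℂ G {z : ℂ | 0 < z.im} := by
    have h := (differentiableOn_iterate hd hm k).comp (f := L) (by fun_prop) hLm
    exact (h.sub_const _).div_const _
  have hGm : Set.MapsTo G {z : ℂ | 0 < z.im} {z : ℂ | 0 < z.im} := by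
    intro ζ hζ
    have := div_pos (orbit_im_pos hm (hLm hζ) k) (orbit_im_pos hm hz₀ (k + n))
    simpa [G, Complex.div_ofReal_im] using this
  have hGg : ∀ u, G (g n u) = g (k + n) u := by
    intro u
    have : L (g n u) = Φ^[n] u := by
      simp only [L, g, renormIterate]
      field_simp
      ring
    simp only [G, this]
    simp only [g, renormIterate, Function.iterate_add_apply]
  have hGI : G I = I := by
    have := hGg z₀
    simpa only [g, renormIterate_self hm hz₀] using this
  have hgz := renormIterate_im_pos hm hz₀ hz n
  have hgw := renormIterate_im_pos hm hz₀ hw n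
  have hwI : c ≤ ‖g n w - I‖ := by
    have := Complex.im_le_norm (g n w - I)
    simp only [sub_im, I_im] at this
    linarith
  have hwI' : g n w ≠ I := by
    intro h
    rw [h, sub_self, norm_zero] at hwI
    linarith
  have hmw : 1 ≤ ‖g (k + n) w + I‖ := by
    have := Complex.im_le_norm (g (k + n) w + I)
    have := renormIterate_im_pos hm hz₀ hw (k + n)
    simp only [add_im, I_im] at *
    linarith
  have h := norm_map_sub_le_of_fixed hGd hGm hGI hgz hgw hwI'
  change ‖G (g n z) - g n z‖ ≤ ‖G (g n z) + I‖ * ‖g n z + I‖ * (pickKernel (g n z) (g n w) + 1) *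
    (‖G (g n w) - g n w‖ / (‖G (g n w) + I‖ * ‖g n w - I‖)) at h
  rw [hGg, hGg] at h
  have hK := pickKernel_nonneg hz hz₀
  have hK' : 0 ≤ pickKernel (g n z) (g n w) := pickKernel_nonneg hgz hgw
  have hKw := pickKernel_nonneg hz hw
  calc _ ≤ _ := h
    _ ≤ pickKernel z z₀ * pickKernel z z₀ * (pickKernel z w + 1) *
        (‖g (k + n) w - g n w‖ / (1 * c)) := by
      gcongr
      · exact norm_renormIterate_add_I_le hd hm hz₀ hz _
      · exact norm_renormIterate_add_I_le hd hm hz₀ hz _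
      · exact pickKernel_renormIterate_le hd hm hz₀ hz hw n
    _ = _ := by rw [one_mul]; ring

end Renormalization

theorem continuousOn_pickKernel {w : ℂ} (hw : 0 < w.im) :
    ContinuousOn (fun z ↦ pickKernel z w) {z : ℂ | 0 < z.im} := by
  unfold pickKernel
  exact ContinuousOn.div (by fun_prop) (by fun_prop) fun z hz ↦ (mul_pos hz hw).ne'

/-- Functions whose increments at `z` are at most `M z` times those of a Cauchy sequence, with `M`
continuous, converge locally uniformly. -/
theorem exists_tendstoLocallyUniformlyOn_of_norm_sub_le {s : Set ℂ} {g : ℕ → ℂ → ℂ} {M : ℂ → ℝ}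
    (hM : ContinuousOn M s) (hM0 : ∀ z ∈ s, 0 ≤ M z) {v : ℕ → ℂ} (hv : CauchySeq v)
    (h : ∀ z ∈ s, ∀ n m, n ≤ m → ‖g m z - g n z‖ ≤ M z * ‖v m - v n‖) :
    ∃ σ : ℂ → ℂ, TendstoLocallyUniformlyOn g σ atTop s := by
  obtain ⟨l, hl⟩ := cauchySeq_tendsto_of_complete hv
  have hlim : ∀ z ∈ s, ∃ l, Tendsto (fun n ↦ g n z) atTop (𝓝 l) := by
    intro z hz
    refine cauchySeq_tendsto_of_complete (Metric.cauchySeq_iff'.2 fun ε hε ↦ ?_)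
    have hMz := hM0 z hz
    obtain ⟨N, hN⟩ := Metric.cauchySeq_iff'.1 hv (ε / (M z + 1)) (by positivity)
    refine ⟨N, fun n hn ↦ ?_⟩
    have h1 := h z hz N n hn
    have h2 := hN n hn
    rw [dist_eq_norm, lt_div_iff₀ (by positivity)] at h2
    rw [dist_eq_norm]
    nlinarith [norm_nonneg (v n - v N)]
  choose! σ hσ using hlim
  have hbound : ∀ z ∈ s, ∀ n, ‖σ z - g n z‖ ≤ M z * ‖l - v n‖ := by
    intro z hz n
    refine le_of_tendsto_of_tendsto ((hσ z hz).sub_const (g n z)).norm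
      (((hl.sub_const (v n)).norm).const_mul (M z)) ?_
    filter_upwards [eventually_ge_atTop n] with m hm using h z hz n m hm
  refine ⟨σ, Metric.tendstoLocallyUniformlyOn_iff.2 fun ε hε x hx ↦ ?_⟩
  refine ⟨{z | M z < M x + 1} ∩ s,
    inter_mem ((hM x hx).eventually (gt_mem_nhds (by linarith))) self_mem_nhdsWithin, ?_⟩
  have hMx := hM0 x hx
  have h0 : Tendsto (fun n ↦ (M x + 1) * ‖l - v n‖) atTop (𝓝 0) := by
    simpa using ((hl.const_sub l).norm).const_mul (M x + 1)
  filter_upwards [h0.eventually (gt_mem_nhds hε)] with n hn z hz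
  rw [dist_eq_norm]
  refine (hbound z hz.2 n).trans_lt (lt_of_le_of_lt ?_ hn)
  exact mul_le_mul_of_nonneg_right (le_of_lt hz.1) (norm_nonneg _)

/-- Valiron's conjugation, via Pommerenke's renormalization. -/
theorem valiron_conjugation (Φ : ℂ → ℂ)
    (hd : DifferentiableOn ℂ Φ {z : ℂ | 0 < z.im})
    (hm : Set.MapsTo Φ {z : ℂ | 0 < z.im} {z : ℂ | 0 < z.im})
    (A : ℝ) (hA1 : 1 < A)
    (hA : IsGLB {r : ℝ | ∃ z : ℂ, 0 < z.im ∧ r = (Φ z).im / z.im} A)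
    (z₀ : ℂ) (hz₀ : 0 < z₀.im) :
    ∃ σ : ℂ → ℂ, ∃ b : ℝ,
      DifferentiableOn ℂ σ {z : ℂ | 0 < z.im} ∧
      Set.MapsTo σ {z : ℂ | 0 < z.im} {z : ℂ | 0 < z.im} ∧
      (∃ z ∈ {z : ℂ | 0 < z.im}, ∃ w ∈ {z : ℂ | 0 < z.im}, σ z ≠ σ w) ∧
      (∀ z ∈ {z : ℂ | 0 < z.im}, σ (Φ z) = A * σ z + b) ∧
      TendstoLocallyUniformlyOn
        (fun n z => (Φ^[n] z - ((Φ^[n] z₀).re : ℂ)) / ((Φ^[n] z₀).im : ℂ))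
        σ atTop {z : ℂ | 0 < z.im} := by
  have hopen : IsOpen {z : ℂ | 0 < z.im} := isOpen_lt continuous_const Complex.continuous_im
  have hΦz₀ : 0 < (Φ z₀).im := hm hz₀
  obtain ⟨b, hb⟩ := exists_tendsto_orbit_re_diff hd hm hz₀ hA1 hA
  have ha := tendsto_orbit_im_ratio hd hm hz₀ hA1 hA
  have haC := (Complex.continuous_ofReal.tendsto A).comp ha
  have hbC := (Complex.continuous_ofReal.tendsto b).comp hb
  have hw : Tendsto (fun n ↦ renormIterate Φ z₀ n (Φ z₀)) atTop (𝓝 (A * I + b)) := by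
    refine ((haC.mul_const I).add hbC).congr fun n ↦ ?_
    rw [renormIterate_map hm hz₀, renormIterate_self hm hz₀]
    rfl
  have hAw : ∀ n, 1 + (A - 1) ≤ (renormIterate Φ z₀ n (Φ z₀)).im := by
    intro n
    have hy := orbit_im_pos hm hz₀ n
    rw [renormIterate_im, le_div_iff₀ hy, ← Function.iterate_succ_apply,
      Function.iterate_succ_apply', add_sub_cancel]
    exact mul_im_le_of_isGLB hA hy
  obtain ⟨σ, hσ⟩ := exists_tendstoLocallyUniformlyOn_of_norm_sub_le
    (M := fun z ↦ pickKernel z z₀ ^ 2 * (pickKernel z (Φ z₀) + 1) / (A - 1))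
    ((((continuousOn_pickKernel hz₀).pow 2).mul
      ((continuousOn_pickKernel hΦz₀).add continuousOn_const)).div_const _)
    (fun z hz ↦ div_nonneg (mul_nonneg (sq_nonneg _)
      (add_nonneg (pickKernel_nonneg hz hΦz₀) zero_le_one)) (by linarith))
    hw.cauchySeq
    fun z hz n m hnm ↦ norm_renormIterate_sub_le hd hm hz₀ (by linarith) hz hΦz₀ hnm (hAw n)
  have hlim : ∀ z : ℂ, 0 < z.im → Tendsto (fun n ↦ renormIterate Φ z₀ n z) atTop (𝓝 (σ z)) :=
    fun z hz ↦ hσ.tendsto_at hz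
  have hσz₀ : σ z₀ = I := by
    refine tendsto_nhds_unique (hlim z₀ hz₀) ?_
    simp only [renormIterate_self hm hz₀, tendsto_const_nhds]
  refine ⟨σ, b, hσ.differentiableOn
    (Eventually.of_forall fun n ↦ differentiableOn_renormIterate hd hm n) hopen, ?_, ?_, ?_,
    hσ⟩
  · intro z hz
    have h1 : 1 ≤ pickKernel z₀ z * (σ z).im :=
      ge_of_tendsto' (((Complex.continuous_im.tendsto _).comp (hlim z hz)).const_mul _)
        fun n ↦ one_le_pickKernel_mul_renormIterate_im hd hm hz₀ hz n
    exact pos_of_mul_pos_right (zero_lt_one.trans_le h1) (pickKernel_nonneg hz₀ hz)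
  · refine ⟨z₀, hz₀, Φ z₀, hΦz₀, fun h ↦ ?_⟩
    rw [hσz₀, tendsto_nhds_unique (hlim _ hΦz₀) hw] at h
    have := congrArg Complex.im h
    simp at this
    linarith
  · intro z hz
    refine tendsto_nhds_unique (hlim (Φ z) (hm hz)) ?_
    refine ((haC.mul ((hlim z hz).comp (tendsto_add_atTop_nat 1))).add hbC).congr fun n ↦ ?_
    rw [renormIterate_map hm hz₀]
    rfl
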